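/- Let n ≥ 3 and let x be an integer with 1 < x < n. If n ≡ 0 (mod 3), x ≡ 2 (mod 3), 2 < x, and 2x < n, then the 5-regular circulant graph C_{2n}(x,1,n) is word-representable. -/

import Mathlib

/-- Two letters `x` and `y` alternate in the word `w` if, after deleting all letters
other than `x` and `y`, no two consecutive letters of the resulting word are equal. -/
def Alternate {V : Type*} [DecidableEq V] (w : List V) (x y : V) : Prop :=
  (w.filter (fun z => decide (z = x ∨ z = y))).Chain' (· ≠ ·)

/-- A word `w` represents the graph `G` if it contains every vertex at least once and
two distinct vertices are adjacent in `G` iff they alternate in `w`. -/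
def Represents {V : Type*} [DecidableEq V] (G : SimpleGraph V) (w : List V) : Prop :=
  (∀ v : V, v ∈ w) ∧ ∀ x y : V, x ≠ y → (G.Adj x y ↔ Alternate w x y)

/-- A graph is word-representable if some word represents it. -/
def WordRepresentable {V : Type*} [DecidableEq V] (G : SimpleGraph V) : Prop :=
  ∃ w : List V, Represents G w

/-- A word is `k`-uniform if every letter of the alphabet occurs in it exactly `k` times. -/
def IsKUniform {V : Type*} [DecidableEq V] (w : List V) (k : ℕ) : Prop :=
  ∀ v : V, w.count v = k

/-! ### Words built from occurrence times -/

section TimedWord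

variable {V : Type*} [Fintype V]

/-- The word in which every letter `v` occurs at the times `r v` and `s v`, letters with a
common time being listed in a fixed order. -/
noncomputable def timedWord (T : ℕ) (r s : V → ℕ) : List V :=
  (List.range T).flatMap fun t => Finset.univ.toList.filter fun v => decide (r v = t ∨ s v = t)

lemma mem_timedWord {T : ℕ} {r s : V → ℕ} {v : V} (h : r v < T) : v ∈ timedWord T r s := by
  simp only [timedWord, List.mem_flatMap, List.mem_range, List.mem_filter, Finset.mem_toList]
  exact ⟨r v, h, by simp⟩

end TimedWord

section Words

variable {V : Type*} [DecidableEq V]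

lemma alternate_iff_isChain {w : List V} {u v : V} :
    Alternate w u v ↔ (w.filter (fun z => decide (z = u ∨ z = v))).IsChain (· ≠ ·) :=
  Iff.rfl

lemma Alternate.symm {w : List V} {u v : V} (h : Alternate w u v) : Alternate w v u := by
  unfold Alternate at *
  simpa only [or_comm] using h

lemma Alternate.of_infix {w w' : List V} {u v : V} (hw : w' <:+: w) (h : Alternate w u v) :
    Alternate w' u v :=
  List.IsChain.infix h (hw.filter _)

lemma alternate_of_filter_eq {w : List V} {u v : V} (huv : u ≠ v) {k : ℕ}
    (h : w.filter (fun z => decide (z = u ∨ z = v)) = (List.replicate k [u, v]).flatten) :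
    Alternate w u v := by
  rw [alternate_iff_isChain, h]
  clear h
  induction k with
  | zero => simp
  | succ k ih =>
    cases k with
    | zero => simpa using huv
    | succ k =>
      simp only [List.replicate_succ, List.flatten_cons, List.cons_append, List.nil_append] at ih ⊢
      exact .cons_cons huv (.cons_cons huv.symm ih)

lemma filter_flatten_eq_replicate {l : List (List V)} {u v : V}
    (h : ∀ w ∈ l, ∃ k, w.filter (fun z => decide (z = u ∨ z = v)) =
      (List.replicate k [u, v]).flatten) :
    ∃ k, l.flatten.filter (fun z => decide (z = u ∨ z = v)) =
      (List.replicate k [u, v]).flatten := by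
  induction l with
  | nil => exact ⟨0, by simp⟩
  | cons w l ih =>
    obtain ⟨k, hk⟩ := h w (by simp)
    obtain ⟨m, hm⟩ := ih fun w' hw' => h w' (by simp [hw'])
    refine ⟨k + m, ?_⟩
    rw [List.flatten_cons, List.filter_append, hk, hm, List.replicate_add, List.flatten_append]

lemma flatMap_range'_eq_nil {α : Type*} {g : ℕ → List α} {s m : ℕ}
    (h : ∀ t, s ≤ t → t < s + m → g t = []) : (List.range' s m).flatMap g = [] := by
  rw [List.flatMap_eq_nil_iff]
  intro t ht
  rw [List.mem_range'_1] at ht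
  exact h t ht.1 ht.2

lemma flatMap_range'_eq_append {α : Type*} {g : ℕ → List α} {s m a : ℕ} (hs : s ≤ a)
    (ha : a < s + m) (h : ∀ t, s ≤ t → t < a → g t = []) :
    (List.range' s m).flatMap g = g a ++ (List.range' (a + 1) (s + m - a - 1)).flatMap g := by
  obtain ⟨d, rfl⟩ := Nat.exists_eq_add_of_le hs
  obtain ⟨e, rfl⟩ : ∃ e, m = d + (e + 1) := ⟨m - d - 1, by omega⟩
  rw [← List.range'_append_1, List.flatMap_append,
    flatMap_range'_eq_nil fun t h₁ h₂ => h t h₁ h₂, List.nil_append, List.range'_succ,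
    List.flatMap_cons]
  congr 3
  omega

lemma flatMap_range_eq_four {α : Type*} {g : ℕ → List α} {T a b c d : ℕ} (hab : a < b)
    (hbc : b < c) (hcd : c < d) (hd : d < T)
    (h : ∀ t, t ≠ a → t ≠ b → t ≠ c → t ≠ d → g t = []) :
    (List.range T).flatMap g = g a ++ g b ++ g c ++ g d := by
  rw [List.range_eq_range',
    flatMap_range'_eq_append (a := a) (by omega) (by omega) fun t _ _ => h t (by omega)
      (by omega) (by omega) (by omega),
    flatMap_range'_eq_append (a := b) (by omega) (by omega) fun t _ _ => h t (by omega)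
      (by omega) (by omega) (by omega),
    flatMap_range'_eq_append (a := c) (by omega) (by omega) fun t _ _ => h t (by omega)
      (by omega) (by omega) (by omega),
    flatMap_range'_eq_append (a := d) (by omega) (by omega) fun t _ _ => h t (by omega)
      (by omega) (by omega) (by omega),
    flatMap_range'_eq_nil fun t _ _ => h t (by omega) (by omega) (by omega) (by omega)]
  simp

lemma filter_pair_filter_eq_singleton {L : List V} (hL : L.Nodup) {u v : V} (hu : u ∈ L)
    {p : V → Bool} (hpu : p u = true) (hpv : p v = false) :
    (L.filter p).filter (fun z => decide (z = u ∨ z = v)) = [u] := by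
  have key : (L.filter p).filter (fun z => decide (z = u ∨ z = v)) = L.filter (· == u) := by
    rw [List.filter_filter]
    refine List.filter_congr fun z _ => ?_
    by_cases hzu : z = u
    · simp [hzu, hpu]
    · by_cases hzv : z = v
      · simp [hzv, hpv, show v ≠ u from fun h => hzu (hzv.trans h)]
      · simp [hzu, hzv]
  rw [key, List.filter_beq, List.count_eq_one_of_mem hL hu]
  rfl

lemma filter_pair_filter_eq_nil {L : List V} {u v : V} {p : V → Bool} (hpu : p u = false)
    (hpv : p v = false) : (L.filter p).filter (fun z => decide (z = u ∨ z = v)) = [] := by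
  rw [List.filter_filter, List.filter_eq_nil_iff]
  rintro z -
  by_cases hzu : z = u
  · simp [hzu, hpu]
  · by_cases hzv : z = v <;> simp [hzu, hzv, hpv]

variable [Fintype V]

lemma filter_timedWord (T : ℕ) (r s : V → ℕ) (u v : V) :
    (timedWord T r s).filter (fun z => decide (z = u ∨ z = v)) =
      (List.range T).flatMap fun t => (Finset.univ.toList.filter fun v =>
        decide (r v = t ∨ s v = t)).filter (fun z => decide (z = u ∨ z = v)) := by
  simp only [timedWord, List.filter_flatMap]

lemma timedWord_slice_left {r s : V → ℕ} {u v : V} {t : ℕ} (hu : r u = t ∨ s u = t)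
    (hv : r v ≠ t ∧ s v ≠ t) :
    (Finset.univ.toList.filter fun v => decide (r v = t ∨ s v = t)).filter
      (fun z => decide (z = u ∨ z = v)) = [u] :=
  filter_pair_filter_eq_singleton (Finset.nodup_toList _) (by simp) (by simpa using hu)
    (by simpa using hv)

lemma timedWord_slice_right {r s : V → ℕ} {u v : V} {t : ℕ} (hv : r v = t ∨ s v = t)
    (hu : r u ≠ t ∧ s u ≠ t) :
    (Finset.univ.toList.filter fun v => decide (r v = t ∨ s v = t)).filter
      (fun z => decide (z = u ∨ z = v)) = [v] := by
  simp only [or_comm (a := _ = u)]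
  exact timedWord_slice_left hv hu

lemma timedWord_slice_nil {r s : V → ℕ} {u v : V} {t : ℕ} (hu : r u ≠ t ∧ s u ≠ t)
    (hv : r v ≠ t ∧ s v ≠ t) :
    (Finset.univ.toList.filter fun v => decide (r v = t ∨ s v = t)).filter
      (fun z => decide (z = u ∨ z = v)) = [] :=
  filter_pair_filter_eq_nil (by simpa using hu) (by simpa using hv)

lemma filter_timedWord_interleaved {T : ℕ} {r s : V → ℕ} {u v : V} (h₁ : r u < r v)
    (h₂ : r v < s u) (h₃ : s u < s v) (h₄ : s v < T) :
    (timedWord T r s).filter (fun z => decide (z = u ∨ z = v)) = [u, v, u, v] := by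
  rw [filter_timedWord, flatMap_range_eq_four h₁ h₂ h₃ h₄ fun t _ _ _ _ =>
      timedWord_slice_nil (by omega) (by omega),
    timedWord_slice_left (by omega) (by omega), timedWord_slice_right (by omega) (by omega),
    timedWord_slice_left (by omega) (by omega), timedWord_slice_right (by omega) (by omega)]
  rfl

lemma not_alternate_timedWord_nested {T : ℕ} {r s : V → ℕ} {u v : V} (h₁ : r u < r v)
    (h₂ : r v < s v) (h₃ : s v < s u) (h₄ : s u < T) : ¬ Alternate (timedWord T r s) u v := by
  rw [alternate_iff_isChain, filter_timedWord, flatMap_range_eq_four h₁ h₂ h₃ h₄ fun t _ _ _ _ =>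
      timedWord_slice_nil (by omega) (by omega),
    timedWord_slice_left (by omega) (by omega), timedWord_slice_right (by omega) (by omega),
    timedWord_slice_right (by omega) (by omega), timedWord_slice_left (by omega) (by omega)]
  simp

lemma not_alternate_timedWord_separated {T : ℕ} {r s : V → ℕ} {u v : V} (h₁ : r u < s u)
    (h₂ : s u < r v) (h₃ : r v < s v) (h₄ : s v < T) : ¬ Alternate (timedWord T r s) u v := by
  rw [alternate_iff_isChain, filter_timedWord, flatMap_range_eq_four h₁ h₂ h₃ h₄ fun t _ _ _ _ =>
      timedWord_slice_nil (by omega) (by omega),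
    timedWord_slice_left (by omega) (by omega), timedWord_slice_left (by omega) (by omega),
    timedWord_slice_right (by omega) (by omega), timedWord_slice_right (by omega) (by omega)]
  simp

end Words

/-! ### Three-colourable graphs are word-representable -/

section ThreeColourable

variable {V : Type*} [DecidableEq V] [Fintype V]

/-- A non-adjacent pair can be separated by a word that respects all edges of a 3-coloured
graph, each oriented towards the larger colour. -/
lemma exists_timedWord_not_alternate {G : SimpleGraph V} {col : V → ℕ} (hlt : ∀ v, col v < 3)
    {a b : V} (hab : a ≠ b) (hadj : ¬ G.Adj a b) (hle : col a ≤ col b) :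
    ∃ w : List V, (∀ v, v ∈ w) ∧ ¬ Alternate w a b ∧
      ∀ u v, G.Adj u v → col u < col v →
        w.filter (fun z => decide (z = u ∨ z = v)) = [u, v, u, v] := by
  have hb := hlt b
  by_cases hclose : col b ≤ col a + 1
  · refine ⟨timedWord 30 (fun z => 3 * col z + if z = b then 1 else 0)
      (fun z => 12 + if z = a then 3 * col a + 2 else if z = b then 3 * col a + 1 else 3 * col z),
      fun v => mem_timedWord ?_, not_alternate_timedWord_nested ?_ ?_ ?_ ?_, fun u v huv hc =>
        filter_timedWord_interleaved ?_ ?_ ?_ ?_⟩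
    · have := hlt v
      split_ifs <;> omega
    · simp only [hab, if_true, if_false]; omega
    · simp only [hab.symm, if_true, if_false]; omega
    · simp only [hab.symm, if_true, if_false]; omega
    · simp only [if_true]; omega
    all_goals
      have hu := hlt u
      have hv := hlt v
    · split_ifs <;> omega
    · split_ifs <;> omega
    · by_cases hua : u = a
      · subst hua
        have hvb : v ≠ b := fun h => hadj (h ▸ huv)
        have hvu : v ≠ u := huv.ne'
        simp only [hvb, hvu, if_true, if_false]; omega
      · by_cases hub : u = b
        · subst hub
          have hvu : v ≠ u := huv.ne'
          have hva : v ≠ a := by rintro rfl; omega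
          simp only [hua, hvu, hva, if_true, if_false]; omega
        · simp only [hua, hub, if_false]
          split_ifs with h₁ h₂
          · subst h₁; omega
          · subst h₂; omega
          · omega
    · split_ifs <;> omega
  · have ha0 : col a = 0 := by omega
    have hb2 : col b = 2 := by omega
    refine ⟨timedWord 30 (fun z => col z + if z = b then 2 else 0)
      (fun z => if z = a then 3 else 5 + col z),
      fun v => mem_timedWord ?_, not_alternate_timedWord_separated ?_ ?_ ?_ ?_, fun u v huv hc =>
        filter_timedWord_interleaved ?_ ?_ ?_ ?_⟩
    · have := hlt v
      split_ifs <;> omega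
    · simp only [hab, if_true, if_false]; omega
    · simp only [if_true]; omega
    · simp only [hab.symm, if_true, if_false]; omega
    · simp only [hab.symm, if_false]; omega
    all_goals
      have hu := hlt u
      have hv := hlt v
    · have hub : u ≠ b := by rintro rfl; omega
      simp only [hub, if_false]; omega
    · by_cases hua : u = a
      · subst hua
        have hvb : v ≠ b := fun h => hadj (h ▸ huv)
        simp only [hvb, if_true, if_false]; omega
      · simp only [hua, if_false]
        split_ifs <;> omega
    · have hva : v ≠ a := by rintro rfl; omega
      simp only [hva, if_false]
      split_ifs <;> omega
    · split_ifs <;> omega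

/-- Every finite 3-colourable graph is word-representable. -/
theorem wordRepresentable_of_three_colouring {G : SimpleGraph V} (col : V → ℕ)
    (hlt : ∀ v, col v < 3) (hcol : ∀ u v, G.Adj u v → col u ≠ col v) : WordRepresentable G := by
  have base : ∀ p : V × V, ∃ w : List V, (∀ v, v ∈ w) ∧
      (p.1 ≠ p.2 → ¬ G.Adj p.1 p.2 → ¬ Alternate w p.1 p.2) ∧
      ∀ u v, G.Adj u v → col u < col v →
        ∃ k, w.filter (fun z => decide (z = u ∨ z = v)) = (List.replicate k [u, v]).flatten := by
    rintro ⟨a, b⟩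
    by_cases h : a ≠ b ∧ ¬ G.Adj a b
    · obtain ⟨hab, hadj⟩ := h
      rcases le_total (col a) (col b) with hle | hle
      · obtain ⟨w, hw, hn, he⟩ := exists_timedWord_not_alternate hlt hab hadj hle
        exact ⟨w, hw, fun _ _ => hn, fun u v huv hc => ⟨2, he u v huv hc⟩⟩
      · obtain ⟨w, hw, hn, he⟩ :=
          exists_timedWord_not_alternate hlt hab.symm (fun h => hadj h.symm) hle
        exact ⟨w, hw, fun _ _ h => hn h.symm, fun u v huv hc => ⟨2, he u v huv hc⟩⟩
    · refine ⟨timedWord 6 col (fun z => 3 + col z), fun v => mem_timedWord ?_,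
        fun h₁ h₂ => absurd ⟨h₁, h₂⟩ h, fun u v _ hc =>
          ⟨2, filter_timedWord_interleaved hc ?_ ?_ ?_⟩⟩
      · have := hlt v; omega
      · have := hlt v; omega
      · omega
      · have := hlt v; omega
  choose W hmem hsep hedge using base
  have hinfix : ∀ p, W p <:+: ((Finset.univ : Finset (V × V)).toList.map W).flatten := fun p =>
    List.infix_of_mem_flatten (List.mem_map_of_mem (by simp))
  have hforward : ∀ u v, G.Adj u v → col u < col v →
      Alternate ((Finset.univ : Finset (V × V)).toList.map W).flatten u v := by
    intro u v huv hc
    obtain ⟨k, hk⟩ := filter_flatten_eq_replicate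
      (l := (Finset.univ : Finset (V × V)).toList.map W) (u := u) (v := v) (by
        intro w hw
        obtain ⟨p, -, rfl⟩ := List.mem_map.1 hw
        exact hedge p u v huv hc)
    exact alternate_of_filter_eq huv.ne hk
  refine ⟨_, fun v => (hinfix (v, v)).subset (hmem _ v), fun u v huv => ⟨fun h => ?_, fun h => ?_⟩⟩
  · rcases lt_or_gt_of_ne (hcol u v h) with hc | hc
    · exact hforward u v h hc
    · exact (hforward v u h.symm hc).symm
  · by_contra hadj
    exact hsep (u, v) huv hadj (h.of_infix (hinfix (u, v)))

end ThreeColourable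

/-! ### Colouring the circulant graphs -/

/-- The colour classes come from the balanced sequence `i ↦ ⌊c i / N⌋`. -/
lemma add_div_mod_three_ne {N c s lo : ℕ} (hN : 0 < N) (hlo : lo * N ≤ c * s)
    (hhi : c * s ≤ (lo + 1) * N) (hmod : (s + lo) % 3 = 1) (i : ℕ) :
    ((i + s) + c * (i + s) / N) % 3 ≠ (i + c * i / N) % 3 := by
  have h₁ : c * i / N + lo ≤ c * (i + s) / N := by
    rw [Nat.le_div_iff_mul_le hN, add_mul, mul_add]
    exact add_le_add (Nat.div_mul_le_self _ _) hlo
  have h₂ : c * (i + s) / N < c * i / N + lo + 2 := by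
    rw [Nat.div_lt_iff_lt_mul hN, mul_add]
    have := Nat.lt_div_mul_add (a := c * i) hN
    nlinarith
  omega

lemma add_div_mod_three_periodic {N c : ℕ} (hN : 0 < N) (hN3 : N % 3 = 0) (hc : c % 3 = 0)
    {i : ℕ} (hi : i < 2 * N) :
    (i % N + c * (i % N) / N) % 3 = (i + c * i / N) % 3 := by
  rcases lt_or_ge i N with h | h
  · rw [Nat.mod_eq_of_lt h]
  · obtain ⟨j, rfl⟩ := Nat.exists_eq_add_of_le' h
    rw [Nat.add_mod_right, Nat.mod_eq_of_lt (show j < N by omega), mul_add, Nat.add_mul_div_right _ _ hN]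
    omega

lemma exists_balanced_density {n x : ℕ} (h0 : n % 3 = 0) (h1 : x % 3 = 2) (h2 : 2 < x)
    (h3 : 2 * x < n) (hne : ¬ (n = 12 ∧ x = 5)) :
    ∃ j m : ℕ, 3 * (2 * j + 1) ≤ 2 * n ∧ (3 * m + 2) * (2 * n) ≤ 3 * (2 * j + 1) * x ∧
      3 * (2 * j + 1) * x ≤ (3 * m + 3) * (2 * n) := by
  by_cases c₁ : 4 * n ≤ 9 * x
  · exact ⟨1, 0, by omega, by omega, by omega⟩
  by_cases c₂ : 2 * n < 5 * x
  · exact ⟨4, 1, by omega, by omega, by omega⟩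
  by_cases c₃ : n < 3 * x
  · exact ⟨2, 0, by omega, by omega, by omega⟩
  have hex : ∃ j : ℕ, 4 * n ≤ 3 * (2 * j + 1) * x := ⟨n, by nlinarith⟩
  classical
  have hmin : ∀ k < Nat.find hex, 3 * (2 * k + 1) * x < 4 * n := fun k hk => by
    simpa using Nat.find_min hex hk
  have hspec := Nat.find_spec hex
  generalize Nat.find hex = j at hmin hspec
  have hupper : 3 * (2 * j + 1) * x ≤ 6 * n := by
    cases j with
    | zero => omega
    | succ k =>
      have := hmin k (by omega)
      nlinarith
  refine ⟨j, 0, ?_, by omega, by omega⟩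
  nlinarith

theorem wordRepresentable_circulantGraph_of_density {n x j m : ℕ} (hn : 0 < n) (hxn : x < n)
    (h0 : n % 3 = 0) (h1 : x % 3 = 2) (hj : 3 * (2 * j + 1) ≤ 2 * n)
    (hlo : (3 * m + 2) * (2 * n) ≤ 3 * (2 * j + 1) * x)
    (hhi : 3 * (2 * j + 1) * x ≤ (3 * m + 3) * (2 * n)) :
    WordRepresentable (SimpleGraph.circulantGraph
      {((1 : ℕ) : ZMod (2*n)), ((x : ℕ) : ZMod (2*n)), ((n : ℕ) : ZMod (2*n))}) := by
  have hN : 0 < 2 * n := by omega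
  have : NeZero (2 * n) := ⟨hN.ne'⟩
  have step : ∀ (a b : ZMod (2 * n)) (s lo : ℕ), s < 2 * n → a - b = (s : ZMod (2 * n)) →
      lo * (2 * n) ≤ 3 * (2 * j + 1) * s → 3 * (2 * j + 1) * s ≤ (lo + 1) * (2 * n) →
      (s + lo) % 3 = 1 →
      (a.val + 3 * (2 * j + 1) * a.val / (2 * n)) % 3 ≠
        (b.val + 3 * (2 * j + 1) * b.val / (2 * n)) % 3 := by
    intro a b s lo hs hab h₁ h₂ hmod
    have hb := ZMod.val_lt b
    have ha : a.val = (b.val + s) % (2 * n) := by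
      rw [sub_eq_iff_eq_add'.1 hab, ZMod.val_add, ZMod.val_natCast, Nat.mod_eq_of_lt hs]
    rw [ha, add_div_mod_three_periodic hN (by omega) (by omega) (by omega)]
    exact add_div_mod_three_ne hN h₁ h₂ hmod _
  have step' : ∀ a b : ZMod (2 * n), a - b ∈
      ({((1 : ℕ) : ZMod (2*n)), ((x : ℕ) : ZMod (2*n)), ((n : ℕ) : ZMod (2*n))} : Set _) →
      (a.val + 3 * (2 * j + 1) * a.val / (2 * n)) % 3 ≠
        (b.val + 3 * (2 * j + 1) * b.val / (2 * n)) % 3 := by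
    rintro a b (h | h | h)
    · exact step a b 1 0 (by omega) h (by omega) (by omega) (by omega)
    · exact step a b x (3 * m + 2) (by omega) h hlo hhi (by omega)
    · exact step a b n (3 * j + 1) (by omega) h (by nlinarith) (by nlinarith) (by omega)
  refine wordRepresentable_of_three_colouring
    (fun a => (a.val + 3 * (2 * j + 1) * a.val / (2 * n)) % 3)
    (fun a => Nat.mod_lt _ (by omega)) fun a b hab => ?_
  rcases ((SimpleGraph.fromRel_adj _ _ _).1 hab).2 with h | h
  · exact step' a b h
  · exact (step' b a h).symm

/-! ### The exceptional graph, which is not 3-colourable -/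

/-- A 4-uniform word representing the circulant graph on `ZMod 24` with jumps `1, 5, 12`. -/
def exceptionalWord : List (ZMod 24) :=
  [20, 9, 6, 18, 2, 14, 7, 1, 19, 5, 11, 6, 12, 22, 3, 23, 0, 10, 16, 11, 15, 17, 21, 4,
    16, 22, 2, 8, 5, 20, 13, 1, 9, 10, 21, 18, 3, 7, 23, 6, 14, 4, 2, 8, 9, 15, 12, 19,
    7, 20, 17, 22, 3, 13, 11, 8, 16, 21, 14, 0, 1, 12, 2, 18, 13, 19, 5, 17, 10, 6, 7, 23,
    18, 22, 11, 0, 12, 4, 23, 5, 15, 16, 17, 3, 9, 4, 10, 14, 20, 8, 15, 19, 1, 13, 21, 0]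

lemma mem_exceptionalWord : ∀ v : ZMod 24, v ∈ exceptionalWord := by
  decide +kernel

lemma adj_iff_chain_exceptionalWord : ∀ u v : ZMod 24, u ≠ v →
    (((u - v = 1 ∨ u - v = 5 ∨ u - v = 12) ∨ (v - u = 1 ∨ v - u = 5 ∨ v - u = 12)) ↔
      (exceptionalWord.filter (fun z => decide (z = u ∨ z = v))).IsChain (· ≠ ·)) := by
  decide +kernel

theorem wordRepresentable_circulantGraph_twentyFour :
    WordRepresentable (SimpleGraph.circulantGraph
      {((1 : ℕ) : ZMod (2*12)), ((5 : ℕ) : ZMod (2*12)), ((12 : ℕ) : ZMod (2*12))}) := by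
  refine ⟨exceptionalWord, mem_exceptionalWord, fun u v huv => ?_⟩
  refine Iff.trans ?_ (adj_iff_chain_exceptionalWord u v huv)
  exact (SimpleGraph.fromRel_adj _ _ _).trans (and_iff_right huv)

theorem stmt8 (n x : ℕ) (hn : 3 ≤ n) (hx1 : 1 < x) (hxn : x < n)
    (h0 : n % 3 = 0) (h1 : x % 3 = 2) (h2 : 2 < x) (h3 : 2*x < n) :
    WordRepresentable (SimpleGraph.circulantGraph {((1 : ℕ) : ZMod (2*n)), ((x : ℕ) : ZMod (2*n)), ((n : ℕ) : ZMod (2*n))}) := by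
  by_cases hexc : n = 12 ∧ x = 5
  · obtain ⟨rfl, rfl⟩ := hexc
    exact wordRepresentable_circulantGraph_twentyFour
  · obtain ⟨j, m, hj, hlo, hhi⟩ := exists_balanced_density h0 h1 h2 h3 hexc
    exact wordRepresentable_circulantGraph_of_density (by omega) hxn h0 h1 hj hlo hhi
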